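/- arXiv:1912.01492 — 3 statements merged into one kernel-verified Lean document; each statement's English description precedes it below -/
import Mathlib

section
/- Let T be a bounded linear operator on a nontrivial complex Hilbert space H, let α, β ≥ 0 with α + β ≥ 1, and let m, r ≥ 1 be real numbers (m a positive integer). Then w^m(T|T|^{α+β−1}) ≤ 2^{−m/r} ‖ |T|^{2rα} + |T*|^{2rβ} ‖^{m/r} − 2^{−m} · inf_{‖x‖=1} ( ⟨|T|^{2α}x, x⟩^{m/2} − ⟨|T*|^{2β}x, x⟩^{m/2} )². -/
open scoped InnerProductSpace NNReal

variable {H : Type*} [NormedAddCommGroup H] [InnerProductSpace ℂ H] [CompleteSpace H]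

/-- The numerical radius `w(T) = sup { |⟨Tx, x⟩| : ‖x‖ = 1 }`. -/
noncomputable def numRadius (T : H →L[ℂ] H) : ℝ :=
  ⨆ x : {x : H // ‖x‖ = 1}, ‖⟪T x.1, x.1⟫_ℂ‖

/-- The absolute value `|T| = (T*T)^(1/2)`. -/
noncomputable def opAbs (T : H →L[ℂ] H) : H →L[ℂ] H :=
  CFC.sqrt (star T * T)

/-- The real power `|T|^s` of the absolute value, via the continuous functional calculus. -/
noncomputable def opAbsPow (T : H →L[ℂ] H) (s : ℝ) : H →L[ℂ] H :=
  CFC.rpow (opAbs T) s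

lemma opAbsPow_eq_cfc (T : H →L[ℂ] H) {s : ℝ} (hs : 0 ≤ s) :
    opAbsPow T s = cfc (fun t : ℝ => √t ^ s) (star T * T) := by
  have hP : 0 ≤ star T * T := star_mul_self_nonneg T
  have h1 : opAbs T = cfc Real.sqrt (star T * T) := by
    rw [opAbs, CFC.sqrt_eq_real_sqrt _ hP, cfcₙ_eq_cfc]
  have h2 : opAbsPow T s = cfc (fun t : ℝ => t ^ s) (opAbs T) :=
    CFC.rpow_eq_cfc_real (a := opAbs T) (y := s) (CFC.sqrt_nonneg _)
  rw [h2, h1, ← cfc_comp (fun t : ℝ => t ^ s) Real.sqrt (star T * T) hP.isSelfAdjoint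
    (Real.continuous_rpow_const hs).continuousOn Real.continuous_sqrt.continuousOn]
  rfl

/-- `T` intertwines the continuous functional calculi of `T*T` and `TT*`. -/
lemma mul_cfc_star_mul_self (T : H →L[ℂ] H) {f : ℝ → ℝ} (hf : Continuous f) :
    T * cfc f (star T * T) = cfc f (T * star T) * T := by
  have hP : IsSelfAdjoint (star T * T) := IsSelfAdjoint.star_mul_self T
  have hQ : IsSelfAdjoint (T * star T) := IsSelfAdjoint.mul_star_self T
  have hpoly (p : Polynomial ℝ) :
      T * Polynomial.aeval (star T * T) p = Polynomial.aeval (T * star T) p * T := by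
    induction p using Polynomial.induction_on' with
    | add p q hp hq => simp only [map_add, mul_add, add_mul, hp, hq]
    | monomial n a =>
      have hn : T * (star T * T) ^ n = (T * star T) ^ n * T :=
        SemiconjBy.pow_right (a := T) (x := star T * T) (y := T * star T)
          (by simp [SemiconjBy, mul_assoc]) n
      simp only [Polynomial.aeval_monomial, ← Algebra.smul_def, mul_smul_comm, smul_mul_assoc, hn]
  set R : ℝ := ‖star T * T‖ + ‖T * star T‖ with hR
  have hmem {a : H →L[ℂ] H} (ha : ‖a‖ ≤ R) {t : ℝ} (ht : t ∈ spectrum ℝ a) :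
      t ∈ Set.Icc (-R) R := by
    rcases subsingleton_or_nontrivial (H →L[ℂ] H) with h | h
    · simp [spectrum.of_subsingleton] at ht
    exact abs_le.mp ((spectrum.norm_le_norm_of_mem ht).trans ha)
  have hclose {a : H →L[ℂ] H} (hsa : IsSelfAdjoint a) (ha : ‖a‖ ≤ R) {p : Polynomial ℝ} {ε : ℝ}
      (hε : 0 < ε) (hp : ∀ x ∈ Set.Icc (-R) R, |p.eval x - f x| < ε) :
      ‖Polynomial.aeval a p - cfc f a‖ ≤ ε := by
    rw [← cfc_polynomial p a hsa, ← cfc_sub _ _ a p.continuous.continuousOn hf.continuousOn]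
    exact norm_cfc_le hε.le fun t ht => (hp t (hmem ha ht)).le
  rw [← sub_eq_zero, ← norm_le_zero_iff]
  refine le_of_forall_pos_le_add fun δ hδ => ?_
  obtain ⟨p, hp⟩ := exists_polynomial_near_of_continuousOn (-R) R f hf.continuousOn
    (δ / (2 * (‖T‖ + 1))) (by positivity)
  have hPc := hclose hP (by simp [hR]) (by positivity) hp
  have hQc := hclose hQ (by simp [hR]) (by positivity) hp
  have hdecomp : T * cfc f (star T * T) - cfc f (T * star T) * T =
      (Polynomial.aeval (T * star T) p - cfc f (T * star T)) * T -
        T * (Polynomial.aeval (star T * T) p - cfc f (star T * T)) := by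
    rw [sub_mul, mul_sub, hpoly]; abel
  rw [hdecomp, zero_add]
  calc _ ≤ ‖Polynomial.aeval (T * star T) p - cfc f (T * star T)‖ * ‖T‖ +
        ‖T‖ * ‖Polynomial.aeval (star T * T) p - cfc f (star T * T)‖ :=
        (norm_sub_le _ _).trans (add_le_add (norm_mul_le _ _) (norm_mul_le _ _))
    _ ≤ δ / (2 * (‖T‖ + 1)) * ‖T‖ + ‖T‖ * (δ / (2 * (‖T‖ + 1))) := by gcongr
    _ = δ * (‖T‖ / (‖T‖ + 1)) := by field_simp; ring
    _ ≤ δ * 1 := by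
        gcongr
        rw [div_le_one (by positivity)]
        linarith
    _ = δ := mul_one δ

lemma re_inner_mono {E : Type*} [NormedAddCommGroup E] [InnerProductSpace ℂ E]
    {A B : E →L[ℂ] E} (h : A ≤ B) (x : E) :
    (⟪A x, x⟫_ℂ).re ≤ (⟪B x, x⟫_ℂ).re := by
  have := ((ContinuousLinearMap.le_def A B).mp h).re_inner_nonneg_left x
  simpa [inner_sub_left] using this

lemma re_inner_opAbsPow_nonneg (T : H →L[ℂ] H) (s : ℝ) (x : H) :
    0 ≤ (⟪opAbsPow T s x, x⟫_ℂ).re := by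
  have h : 0 ≤ opAbsPow T s := CFC.rpow_nonneg (a := opAbs T) (y := s)
  simpa using re_inner_mono h x

lemma nonneg_of_mem_spectrum_star_mul_self (T : H →L[ℂ] H) {t : ℝ}
    (ht : t ∈ spectrum ℝ (star T * T)) : 0 ≤ t :=
  spectrum_nonneg_of_nonneg (star_mul_self_nonneg T) ht

lemma norm_apply_sq_eq_re_inner (A : H →L[ℂ] H) (x : H) :
    ‖A x‖ ^ 2 = (⟪(star A * A) x, x⟫_ℂ).re := by
  have h : ⟪(star A * A) x, x⟫_ℂ = ⟪A x, A x⟫_ℂ := by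
    rw [mul_apply_eq_comp, ContinuousLinearMap.star_eq_adjoint,
      ContinuousLinearMap.adjoint_inner_left]
  rw [h, inner_self_eq_norm_sq_to_K]
  norm_cast

lemma norm_mul_cfc_le (T : H →L[ℂ] H) {f : ℝ → ℝ} (hf : Continuous f) {c : ℝ} (hc : 0 ≤ c)
    (h : ∀ t, 0 ≤ t → √t * |f t| ≤ c) : ‖T * cfc f (star T * T)‖ ≤ c := by
  have hstar : star (cfc f (star T * T)) = cfc f (star T * T) := IsSelfAdjoint.star_eq (cfc_predicate f _)
  have heq : star (T * cfc f (star T * T)) * (T * cfc f (star T * T)) =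
      cfc (fun t => f t * (t * f t)) (star T * T) := by
    rw [cfc_mul f (fun t => t * f t) _ hf.continuousOn (by fun_prop),
      cfc_mul (fun t => t) f _ (by fun_prop) hf.continuousOn,
      cfc_id' ℝ (star T * T) (IsSelfAdjoint.star_mul_self T), star_mul, hstar]
    simp only [mul_assoc]
  have hn : ‖T * cfc f (star T * T)‖ * ‖T * cfc f (star T * T)‖ ≤ c * c := by
    rw [← CStarRing.norm_star_mul_self, heq]
    refine norm_cfc_le (by positivity) fun t ht => ?_
    have ht0 := nonneg_of_mem_spectrum_star_mul_self T ht
    have h' := h t ht0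
    rw [Real.norm_eq_abs, abs_mul, abs_mul, abs_of_nonneg ht0]
    calc |f t| * (t * |f t|) = (√t * |f t|) * (√t * |f t|) := by
          linear_combination -(|f t| * |f t|) * Real.mul_self_sqrt ht0
      _ ≤ c * c := by gcongr
  exact abs_le_of_sq_le_sq' (by nlinarith) hc |>.2

/-- Mixed Schwarz inequality for `T |T|^α g(|T|)` where `u * g u ≤ u ^ β`. -/
lemma norm_inner_mul_cfc_le (T : H →L[ℂ] H) {α β : ℝ} (hα : 0 ≤ α) (hβ : 0 ≤ β) {g : ℝ → ℝ}
    (hg : Continuous g) (hg0 : ∀ u, 0 ≤ g u) (hgβ : ∀ u, 0 ≤ u → u * g u ≤ u ^ β) (x : H) :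
    ‖⟪(T * cfc (fun t => √t ^ α * g √t) (star T * T)) x, x⟫_ℂ‖ ≤
      √((⟪opAbsPow T (2 * α) x, x⟫_ℂ).re * (⟪opAbsPow (star T) (2 * β) x, x⟫_ℂ).re) := by
  have hcα : Continuous fun t : ℝ => √t ^ α := Real.continuous_sqrt.rpow_const fun _ => .inr hα
  have hcβ : Continuous fun t : ℝ => √t ^ (2 * β) :=
    Real.continuous_sqrt.rpow_const fun _ => .inr (by positivity)
  have hcg : Continuous fun t : ℝ => g √t := hg.comp Real.continuous_sqrt
  set P := star T * T with hPdef
  set A := cfc (fun t : ℝ => √t ^ α) P with hA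
  set G := cfc (fun t : ℝ => g √t) P with hG
  have hAs : star A = A := IsSelfAdjoint.star_eq (cfc_predicate _ P)
  have hGs : star G = G := IsSelfAdjoint.star_eq (cfc_predicate _ P)
  have hAG : cfc (fun t => √t ^ α * g √t) P = G * A := by
    rw [hG, hA, ← cfc_mul _ _ P hcg.continuousOn hcα.continuousOn]
    simp only [mul_comm]
  have h1 : ‖A x‖ ^ 2 = (⟪opAbsPow T (2 * α) x, x⟫_ℂ).re := by
    rw [norm_apply_sq_eq_re_inner, hAs, opAbsPow_eq_cfc T (by positivity), hA,
      ← cfc_mul _ _ P hcα.continuousOn hcα.continuousOn]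
    congr 5
    ext t
    rw [two_mul, Real.rpow_add_of_nonneg (Real.sqrt_nonneg t) hα hα]
  have h2 : ‖(star (T * G)) x‖ ^ 2 ≤ (⟪opAbsPow (star T) (2 * β) x, x⟫_ℂ).re := by
    rw [norm_apply_sq_eq_re_inner, star_star]
    refine re_inner_mono ?_ x
    have hQ : IsSelfAdjoint (T * star T) := IsSelfAdjoint.mul_star_self T
    have heq : T * G * star (T * G) =
        cfc (fun t => g √t * g √t * t) (T * star T) := by
      rw [cfc_mul (fun t => g √t * g √t) (fun t => t) _ (by fun_prop) (by fun_prop),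
        cfc_mul _ _ _ hcg.continuousOn hcg.continuousOn, cfc_id' ℝ _ hQ, star_mul, hGs, hG,
        mul_cfc_star_mul_self T hcg]
      have h3 := mul_cfc_star_mul_self T hcg
      rw [mul_assoc, ← mul_assoc T, h3]
      simp only [mul_assoc]
    rw [heq, opAbsPow_eq_cfc (star T) (by positivity), star_star]
    refine cfc_mono (fun t ht => ?_) (by fun_prop) hcβ.continuousOn
    have ht0 : 0 ≤ t := spectrum_nonneg_of_nonneg (mul_star_self_nonneg T) ht
    have h4 := hgβ √t (Real.sqrt_nonneg t)
    have h5 : 0 ≤ √t * g √t := mul_nonneg (Real.sqrt_nonneg t) (hg0 _)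
    calc g √t * g √t * t = (√t * g √t) * (√t * g √t) := by
          linear_combination -(g √t * g √t) * Real.mul_self_sqrt ht0
      _ ≤ √t ^ β * √t ^ β := by gcongr
      _ = √t ^ (2 * β) := by
          rw [two_mul, Real.rpow_add_of_nonneg (Real.sqrt_nonneg t) hβ hβ]
  have h6 : ⟪(T * cfc (fun t => √t ^ α * g √t) P) x, x⟫_ℂ = ⟪A x, star (T * G) x⟫_ℂ := by
    rw [hAG, ← mul_assoc, ContinuousLinearMap.star_eq_adjoint,
      ContinuousLinearMap.adjoint_inner_right]
    rfl
  rw [h6]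
  refine Real.le_sqrt_of_sq_le ?_
  calc _ ≤ (‖A x‖ * ‖star (T * G) x‖) ^ 2 := by
        gcongr
        exact norm_inner_le_norm _ _
    _ = ‖A x‖ ^ 2 * ‖star (T * G) x‖ ^ 2 := mul_pow _ _ _
    _ ≤ _ := by
        rw [h1]
        exact mul_le_mul_of_nonneg_left h2 (re_inner_opAbsPow_nonneg T _ x)

lemma norm_inner_mul_opAbsPow_le (T : H →L[ℂ] H) {α β : ℝ} (hα : 0 ≤ α) (hβ : 0 ≤ β)
    (hαβ : 1 ≤ α + β) {x : H} (hx : ‖x‖ = 1) :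
    ‖⟪(T * opAbsPow T (α + β - 1)) x, x⟫_ℂ‖ ≤
      √((⟪opAbsPow T (2 * α) x, x⟫_ℂ).re * (⟪opAbsPow (star T) (2 * β) x, x⟫_ℂ).re) := by
  have hs : 0 ≤ α + β - 1 := by linarith
  have hcα : Continuous fun t : ℝ => √t ^ α := Real.continuous_sqrt.rpow_const fun _ => .inr hα
  have hcs : Continuous fun t : ℝ => √t ^ (α + β - 1) :=
    Real.continuous_sqrt.rpow_const fun _ => .inr hs
  rw [opAbsPow_eq_cfc T hs]
  rcases le_total 1 β with h1 | h1
  · have hb : 0 ≤ β - 1 := by linarith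
    have key := norm_inner_mul_cfc_le T hα hβ (g := fun u => |u| ^ (β - 1))
      (continuous_abs.rpow_const fun _ => .inr hb) (fun u => by positivity)
      (fun u hu => by
        rw [abs_of_nonneg hu]
        nth_rewrite 1 [← Real.rpow_one u]
        rw [← Real.rpow_add_of_nonneg hu zero_le_one hb]
        simp) x
    convert key using 6
    ext t
    rw [abs_of_nonneg (Real.sqrt_nonneg t), ← Real.rpow_add_of_nonneg (Real.sqrt_nonneg t) hα hb]
    ring_nf
  · refine le_of_forall_pos_le_add fun δ hδ => ?_
    obtain ⟨ε, hε, hε1, hεδ⟩ : ∃ ε : ℝ, 0 < ε ∧ ε ≤ 1 ∧ ε ≤ δ :=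
      ⟨min 1 δ, by positivity, min_le_left _ _, min_le_right _ _⟩
    have hmax (u : ℝ) : 0 < max u ε := lt_max_of_lt_right hε
    set g : ℝ → ℝ := fun u => max u ε ^ (β - 1) with hgdef
    have hg : Continuous g :=
      (continuous_id.max continuous_const).rpow_const fun u => .inl (hmax u).ne'
    have hg0 (u : ℝ) : 0 ≤ g u := Real.rpow_nonneg (hmax u).le _
    have hgle {u : ℝ} (hu : 0 < u) : g u ≤ u ^ (β - 1) :=
      Real.rpow_le_rpow_of_nonpos hu (le_max_left _ _) (by linarith)
    have hgβ (u : ℝ) (hu : 0 ≤ u) : u * g u ≤ u ^ β := by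
      rcases hu.eq_or_lt with rfl | hu
      · simpa using Real.rpow_nonneg le_rfl β
      · calc u * g u ≤ u * u ^ (β - 1) := by gcongr; exact hgle hu
          _ = u ^ β := by
            nth_rewrite 1 [← Real.rpow_one u]
            rw [← Real.rpow_add hu]
            simp
    have hcg : Continuous fun t : ℝ => √t ^ α * g √t := hcα.mul (hg.comp Real.continuous_sqrt)
    have key := norm_inner_mul_cfc_le T hα hβ hg hg0 hgβ x
    have herr : ‖T * cfc (fun t => √t ^ (α + β - 1) - √t ^ α * g √t) (star T * T)‖ ≤ ε := by
      refine norm_mul_cfc_le T (hcs.sub hcg) hε.le fun t _ => ?_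
      rcases (Real.sqrt_nonneg t).eq_or_lt with h0 | hu
      · rw [← h0, zero_mul]; exact hε.le
      set u := √t with hu_def
      rw [Pi.sub_apply, ← hu_def]
      have hsplit : u ^ (α + β - 1) = u ^ α * u ^ (β - 1) := by
        rw [← Real.rpow_add hu]; ring_nf
      rcases le_total ε u with hεu | hεu
      · have : g u = u ^ (β - 1) := by simp only [hgdef, max_eq_left hεu]
        rw [this, hsplit, sub_self, abs_zero, mul_zero]; exact hε.le
      · have hnn : 0 ≤ u ^ α * g u := mul_nonneg (by positivity) (hg0 u)
        have hle : u ^ α * g u ≤ u ^ (α + β - 1) := by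
          rw [hsplit]
          exact mul_le_mul_of_nonneg_left (hgle hu) (by positivity)
        rw [abs_of_nonneg (by linarith)]
        have h1' : u ^ (α + β - 1) ≤ 1 := Real.rpow_le_one hu.le (hεu.trans hε1) hs
        calc u * (u ^ (α + β - 1) - u ^ α * g u) ≤ u * 1 := by gcongr; linarith
          _ ≤ ε := by linarith
    rw [cfc_sub _ _ _ hcs.continuousOn hcg.continuousOn, mul_sub] at herr
    set S := T * cfc (fun t : ℝ => √t ^ (α + β - 1)) (star T * T)
    set S' := T * cfc (fun t : ℝ => √t ^ α * g √t) (star T * T)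
    have hdiff : ‖⟪(S - S') x, x⟫_ℂ‖ ≤ ε :=
      calc _ ≤ ‖(S - S') x‖ * ‖x‖ := norm_inner_le_norm _ _
        _ ≤ ‖S - S'‖ * ‖x‖ * ‖x‖ := by gcongr; exact (S - S').le_opNorm x
        _ ≤ ε := by simpa [hx] using herr
    have hsum : ⟪S x, x⟫_ℂ = ⟪S' x, x⟫_ℂ + ⟪(S - S') x, x⟫_ℂ := by
      rw [← inner_add_left]; simp
    rw [hsum]
    exact (norm_add_le _ _).trans (add_le_add key (hdiff.trans hεδ))

lemma rpow_tangent_le {a t r : ℝ} (ha : 0 < a) (ht : 0 ≤ t) (hr : 1 ≤ r) :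
    (a ^ r - r * a ^ r) + (r * a ^ r / a) * t ≤ t ^ r := by
  have h := one_add_mul_self_le_rpow_one_add (s := t / a - 1)
    (by have : 0 ≤ t / a := by positivity
        linarith) hr
  have har : 0 < a ^ r := Real.rpow_pos_of_pos ha r
  rw [add_sub_cancel, Real.div_rpow ht ha.le, le_div_iff₀ har] at h
  calc _ = (1 + r * (t / a - 1)) * a ^ r := by field_simp; ring
    _ ≤ _ := h

/-- McCarthy's inequality for powers of `|T|`. -/
lemma re_inner_opAbsPow_rpow_le (T : H →L[ℂ] H) {s r : ℝ} (hs : 0 ≤ s) (hr : 1 ≤ r) {x : H}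
    (hx : ‖x‖ = 1) :
    (⟪opAbsPow T s x, x⟫_ℂ).re ^ r ≤ (⟪opAbsPow T (r * s) x, x⟫_ℂ).re := by
  have hrs : 0 ≤ r * s := by positivity
  rcases (re_inner_opAbsPow_nonneg T s x).eq_or_lt with h0 | ha
  · rw [← h0, Real.zero_rpow (by linarith)]
    exact re_inner_opAbsPow_nonneg T _ x
  set a := (⟪opAbsPow T s x, x⟫_ℂ).re with hadef
  have hc : Continuous fun t : ℝ => √t ^ s := Real.continuous_sqrt.rpow_const fun _ => .inr hs
  have hcr : Continuous fun t : ℝ => √t ^ (r * s) :=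
    Real.continuous_sqrt.rpow_const fun _ => .inr hrs
  set k := a ^ r - r * a ^ r with hk
  set l := r * a ^ r / a with hl
  have hop : algebraMap ℝ (H →L[ℂ] H) k + l • opAbsPow T s ≤ opAbsPow T (r * s) := by
    rw [opAbsPow_eq_cfc T hs, opAbsPow_eq_cfc T hrs,
      ← cfc_const_mul l _ _ hc.continuousOn,
      ← cfc_const_add k _ _ (by fun_prop) (IsSelfAdjoint.star_mul_self T)]
    refine cfc_mono (fun t _ => ?_) (by fun_prop) hcr.continuousOn
    rw [mul_comm r s, Real.rpow_mul (Real.sqrt_nonneg t)]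
    exact rpow_tangent_le ha (by positivity) hr
  have h := re_inner_mono hop x
  have hL : (⟪(algebraMap ℝ (H →L[ℂ] H) k + l • opAbsPow T s) x, x⟫_ℂ).re = k + l * a := by
    rw [Algebra.algebraMap_eq_smul_one]
    simp [inner_smul_left_eq_smul, hx, hadef]
  rw [hL] at h
  have : k + l * a = a ^ r := by rw [hk, hl]; field_simp; ring
  linarith

lemma pow_add_pow_add_le_add_sq_pow {p q : ℝ} (hp : 0 ≤ p) (hq : 0 ≤ q) {m : ℕ} (hm : 1 ≤ m) :
    2 ^ m * (p * q) ^ m + (p ^ m - q ^ m) ^ 2 ≤ (p ^ 2 + q ^ 2) ^ m := by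
  induction m, hm using Nat.le_induction with
  | base => nlinarith
  | succ n hn ih =>
    have h2 : (2 : ℝ) ≤ 2 ^ n := by
      calc (2 : ℝ) = 2 ^ 1 := by norm_num
        _ ≤ 2 ^ n := pow_le_pow_right₀ (by norm_num) hn
    have h3 : 0 ≤ ((2 : ℝ) ^ n - 2) * (p * q) ^ n * (p - q) ^ 2 :=
      mul_nonneg (mul_nonneg (by linarith) (by positivity)) (sq_nonneg _)
    calc _ ≤ (2 ^ n * (p * q) ^ n + (p ^ n - q ^ n) ^ 2) * (p ^ 2 + q ^ 2) := by
          rw [mul_pow] at h3 ⊢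
          rw [mul_pow]
          simp only [pow_succ] at h3 ⊢
          nlinarith [sq_nonneg (p * q ^ n - q * p ^ n)]
      _ ≤ _ := by
          rw [pow_succ (p ^ 2 + q ^ 2)]
          gcongr

lemma half_add_le_half_add_rpow {a b r : ℝ} (ha : 0 ≤ a) (hb : 0 ≤ b) (hr : 1 ≤ r) :
    (a + b) / 2 ≤ ((a ^ r + b ^ r) / 2) ^ (1 / r) := by
  have h := (convexOn_rpow hr).2 (Set.mem_Ici.mpr ha) (Set.mem_Ici.mpr hb)
    (one_half_pos (α := ℝ)).le (one_half_pos (α := ℝ)).le (add_halves 1)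
  simp only [smul_eq_mul] at h
  rw [one_div, Real.le_rpow_inv_iff_of_pos (by positivity) (by positivity) (by linarith)]
  calc ((a + b) / 2) ^ r = (1 / 2 * a + 1 / 2 * b) ^ r := by ring_nf
    _ ≤ _ := h
    _ = _ := by ring

lemma sqrt_mul_pow_le {a b r N : ℝ} (ha : 0 ≤ a) (hb : 0 ≤ b) (hr : 1 ≤ r)
    (hN : a ^ r + b ^ r ≤ N) {m : ℕ} (hm : 1 ≤ m) :
    √(a * b) ^ m ≤ (2 : ℝ) ^ (-(m : ℝ) / r) * N ^ ((m : ℝ) / r) -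
      (2 : ℝ) ^ (-(m : ℝ)) * (a ^ ((m : ℝ) / 2) - b ^ ((m : ℝ) / 2)) ^ 2 := by
  have hN0 : 0 ≤ N := le_trans (by positivity) hN
  have hpow {c : ℝ} (hc : 0 ≤ c) : c ^ ((m : ℝ) / 2) = √c ^ m := by
    rw [Real.sqrt_eq_rpow, ← Real.rpow_natCast, ← Real.rpow_mul hc]
    ring_nf
  have h1 := pow_add_pow_add_le_add_sq_pow (Real.sqrt_nonneg a) (Real.sqrt_nonneg b) hm
  rw [Real.sq_sqrt ha, Real.sq_sqrt hb, ← Real.sqrt_mul ha] at h1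
  have h2 : ((a + b) / 2) ^ m ≤ (N / 2) ^ ((m : ℝ) / r) := by
    calc ((a + b) / 2) ^ m ≤ (((a ^ r + b ^ r) / 2) ^ (1 / r)) ^ m := by
          gcongr
          exact half_add_le_half_add_rpow ha hb hr
      _ ≤ ((N / 2) ^ (1 / r)) ^ m := by gcongr
      _ = _ := by
          rw [← Real.rpow_natCast, ← Real.rpow_mul (by positivity)]
          ring_nf
  have h3 : (2 : ℝ) ^ (-(m : ℝ) / r) * N ^ ((m : ℝ) / r) = (N / 2) ^ ((m : ℝ) / r) := by
    rw [Real.div_rpow hN0 zero_le_two, neg_div, Real.rpow_neg zero_le_two]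
    field_simp
  rw [h3, hpow ha, hpow hb, Real.rpow_neg zero_le_two, Real.rpow_natCast]
  have h4 : ((a + b) / 2) ^ m = (2 ^ m)⁻¹ * (a + b) ^ m := by rw [div_pow]; field_simp
  have h5 := mul_le_mul_of_nonneg_left h1 (inv_nonneg.mpr (pow_nonneg zero_le_two m) :
    (0 : ℝ) ≤ (2 ^ m)⁻¹)
  rw [mul_add, ← mul_assoc, inv_mul_cancel₀ (by positivity), one_mul, ← h4] at h5
  linarith

theorem stmt0 [Nontrivial H] (T : H →L[ℂ] H) (α β : ℝ) (hα : 0 ≤ α) (hβ : 0 ≤ β)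
    (hαβ : 1 ≤ α + β) (m : ℕ) (hm : 1 ≤ m) (r : ℝ) (hr : 1 ≤ r) :
    numRadius (T * opAbsPow T (α + β - 1)) ^ m ≤
      (2 : ℝ) ^ (-(m : ℝ) / r) *
          ‖opAbsPow T (2 * r * α) + opAbsPow (star T) (2 * r * β)‖ ^ ((m : ℝ) / r) -
        (2 : ℝ) ^ (-(m : ℝ)) *
          ⨅ x : {x : H // ‖x‖ = 1},
            ((⟪(opAbsPow T (2 * α)) x.1, x.1⟫_ℂ).re ^ ((m : ℝ) / 2) -
              (⟪(opAbsPow (star T) (2 * β)) x.1, x.1⟫_ℂ).re ^ ((m : ℝ) / 2)) ^ 2 := by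
  have : Nonempty {x : H // ‖x‖ = 1} := by
    obtain ⟨x, hx⟩ := exists_norm_eq H zero_le_one
    exact ⟨⟨x, hx⟩⟩
  rw [numRadius]
  set S := T * opAbsPow T (α + β - 1)
  set N := ‖opAbsPow T (2 * r * α) + opAbsPow (star T) (2 * r * β)‖
  set C := (2 : ℝ) ^ (-(m : ℝ) / r) * N ^ ((m : ℝ) / r)
  set F : {x : H // ‖x‖ = 1} → ℝ := fun x =>
    ((⟪(opAbsPow T (2 * α)) x.1, x.1⟫_ℂ).re ^ ((m : ℝ) / 2) -
      (⟪(opAbsPow (star T) (2 * β)) x.1, x.1⟫_ℂ).re ^ ((m : ℝ) / 2)) ^ 2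
  have hF : BddBelow (Set.range F) := ⟨0, by rintro _ ⟨x, rfl⟩; exact sq_nonneg _⟩
  have hpt (x : {x : H // ‖x‖ = 1}) :
      ‖⟪S x.1, x.1⟫_ℂ‖ ^ m ≤ C - (2 : ℝ) ^ (-(m : ℝ)) * ⨅ x, F x := by
    have hN : (⟪opAbsPow T (2 * α) x.1, x.1⟫_ℂ).re ^ r +
        (⟪opAbsPow (star T) (2 * β) x.1, x.1⟫_ℂ).re ^ r ≤ N := by
      have h1 := re_inner_opAbsPow_rpow_le T (s := 2 * α) (by positivity) hr x.2
      have h2 := re_inner_opAbsPow_rpow_le (star T) (s := 2 * β) (by positivity) hr x.2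
      rw [show r * (2 * α) = 2 * r * α by ring] at h1
      rw [show r * (2 * β) = 2 * r * β by ring] at h2
      refine (add_le_add h1 h2).trans ?_
      rw [← Complex.add_re, ← inner_add_left, ← add_apply]
      refine (Complex.re_le_norm _).trans ((norm_inner_le_norm _ _).trans ?_)
      rw [x.2, mul_one]
      exact ContinuousLinearMap.unit_le_opNorm _ _ x.2.le
    calc _ ≤ √((⟪opAbsPow T (2 * α) x.1, x.1⟫_ℂ).re *
          (⟪opAbsPow (star T) (2 * β) x.1, x.1⟫_ℂ).re) ^ m := by
          gcongr
          exact norm_inner_mul_opAbsPow_le T hα hβ hαβ x.2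
      _ ≤ C - (2 : ℝ) ^ (-(m : ℝ)) * F x :=
          sqrt_mul_pow_le (re_inner_opAbsPow_nonneg T _ _)
            (re_inner_opAbsPow_nonneg (star T) _ _) hr hN hm
      _ ≤ _ := by
          gcongr
          exact ciInf_le hF x
  set D := C - (2 : ℝ) ^ (-(m : ℝ)) * ⨅ x, F x
  have hD : 0 ≤ D := le_trans (by positivity) (hpt (Classical.arbitrary _))
  have hm0 : m ≠ 0 := by omega
  have hsup : ⨆ x : {x : H // ‖x‖ = 1}, ‖⟪S x.1, x.1⟫_ℂ‖ ≤ D ^ (m : ℝ)⁻¹ :=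
    ciSup_le fun x => by
      rw [← Real.pow_rpow_inv_natCast (norm_nonneg ⟪S x.1, x.1⟫_ℂ) hm0]
      exact Real.rpow_le_rpow (by positivity) (hpt x) (by positivity)
  calc _ ≤ (D ^ (m : ℝ)⁻¹) ^ m :=
        pow_le_pow_left₀ (Real.iSup_nonneg fun x => norm_nonneg _) hsup m
    _ = D := Real.rpow_inv_natCast_pow hD hm0
end

section
/- Let T be a bounded linear operator on a nontrivial complex Hilbert space H. Then w²(T) ≤ (1/4) ‖ |T| + |T*| ‖² − (1/4) · inf_{‖x‖=1} ( ⟨|T|x, x⟩ − ⟨|T*|x, x⟩ )². -/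
open scoped InnerProductSpace NNReal

variable {H : Type*} [NormedAddCommGroup H] [InnerProductSpace ℂ H] [CompleteSpace H]

/-- If `t` intertwines the self-adjoint elements `a` and `b`, then it intertwines their images
under the continuous functional calculus. -/
theorem mul_cfc_eq_cfc_mul {A : Type*} [CStarAlgebra A] {a b t : A} (ha : IsSelfAdjoint a)
    (hb : IsSelfAdjoint b) (h : t * a = b * t) {f : ℝ → ℝ} (hf : Continuous f) :
    t * cfc f a = cfc f b * t := by
  have hpoly (p : Polynomial ℝ) : t * Polynomial.aeval a p = Polynomial.aeval b p * t := by
    induction p using Polynomial.induction_on' with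
    | add p q hp hq => simp only [map_add, mul_add, add_mul, hp, hq]
    | monomial n r =>
      have hn : t * a ^ n = b ^ n * t := (SemiconjBy.pow_right (a := t) h n)
      rw [Polynomial.aeval_monomial, Polynomial.aeval_monomial, ← Algebra.smul_def,
        ← Algebra.smul_def, mul_smul_comm, smul_mul_assoc, hn]
  obtain ⟨M, hM⟩ : ∃ M : ℝ, ∀ x ∈ spectrum ℝ a ∪ spectrum ℝ b, |x| ≤ M := by
    have hc : IsCompact (spectrum ℝ a ∪ spectrum ℝ b) :=
      (ContinuousFunctionalCalculus.isCompact_spectrum a).union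
        (ContinuousFunctionalCalculus.isCompact_spectrum b)
    exact hc.exists_bound_of_continuousOn continuousOn_id
  have key (ε : ℝ) (hε : 0 < ε) : ‖t * cfc f a - cfc f b * t‖ ≤ ε * (2 * ‖t‖) := by
    obtain ⟨p, hp⟩ := exists_polynomial_near_of_continuousOn (-M) M f hf.continuousOn ε hε
    have hclose (c : A) (hc : IsSelfAdjoint c)
        (hs : spectrum ℝ c ⊆ spectrum ℝ a ∪ spectrum ℝ b) :
        ‖cfc f c - Polynomial.aeval c p‖ ≤ ε := by
      rw [← cfc_polynomial p c hc, ← cfc_sub f p.eval c hf.continuousOn]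
      refine norm_cfc_le hε.le fun x hx => ?_
      rw [Real.norm_eq_abs, abs_sub_comm]
      exact (hp x (abs_le.mp (hM x (hs hx)))).le
    calc ‖t * cfc f a - cfc f b * t‖
        = ‖t * (cfc f a - Polynomial.aeval a p) - (cfc f b - Polynomial.aeval b p) * t‖ := by
          rw [mul_sub, sub_mul, hpoly]; congr 1; abel
      _ ≤ ‖t‖ * ε + ε * ‖t‖ := by
          refine (norm_sub_le _ _).trans (add_le_add ?_ ?_)
          · exact (norm_mul_le _ _).trans
              (mul_le_mul_of_nonneg_left (hclose a ha Set.subset_union_left) (norm_nonneg _))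
          · exact (norm_mul_le _ _).trans
              (mul_le_mul_of_nonneg_right (hclose b hb Set.subset_union_right) (norm_nonneg _))
      _ = ε * (2 * ‖t‖) := by ring
  have hle : ‖t * cfc f a - cfc f b * t‖ ≤ 0 := by
    have hlim : Filter.Tendsto (fun ε : ℝ => ε * (2 * ‖t‖)) (nhdsWithin 0 (Set.Ioi 0))
        (nhds 0) := by
      have hcont : Continuous fun ε : ℝ => ε * (2 * ‖t‖) := by fun_prop
      simpa using (hcont.tendsto 0).mono_left nhdsWithin_le_nhds
    exact ge_of_tendsto hlim (Filter.eventually_of_mem self_mem_nhdsWithin key)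
  exact sub_eq_zero.mp (norm_le_zero_iff.mp hle)

theorem opAbs_nonneg (T : H →L[ℂ] H) : 0 ≤ opAbs T :=
  CFC.sqrt_nonneg _

theorem opAbs_mul_self (T : H →L[ℂ] H) : opAbs T * opAbs T = star T * T :=
  CFC.sqrt_mul_sqrt_self _ (star_mul_self_nonneg T)

theorem mul_opAbs (T : H →L[ℂ] H) : T * opAbs T = opAbs (star T) * T := by
  have h₁ : 0 ≤ star T * T := star_mul_self_nonneg T
  have h₂ : 0 ≤ T * star T := mul_star_self_nonneg T
  rw [opAbs, opAbs, star_star, CFC.sqrt_eq_real_sqrt _ h₁, CFC.sqrt_eq_real_sqrt _ h₂,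
    cfcₙ_eq_cfc, cfcₙ_eq_cfc]
  exact mul_cfc_eq_cfc_mul (.of_nonneg h₁) (.of_nonneg h₂) (mul_assoc _ _ _).symm
    Real.continuous_sqrt

theorem inner_apply_comm_of_nonneg {E : Type*} [NormedAddCommGroup E] [InnerProductSpace ℂ E]
    {A : E →L[ℂ] E} (hA : 0 ≤ A) (x y : E) :
    ⟪A x, y⟫_ℂ = ⟪x, A y⟫_ℂ :=
  ((ContinuousLinearMap.nonneg_iff_isPositive A).mp hA).inner_left_eq_inner_right x y

theorem re_inner_apply_self_nonneg {E : Type*} [NormedAddCommGroup E] [InnerProductSpace ℂ E]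
    {A : E →L[ℂ] E} (hA : 0 ≤ A) (x : E) :
    0 ≤ (⟪A x, x⟫_ℂ).re :=
  ((ContinuousLinearMap.nonneg_iff_isPositive A).mp hA).re_inner_nonneg_left x

/-- The Cauchy-Schwarz inequality for the form of a positive operator. -/
theorem norm_inner_apply_sq_le_of_nonneg {A : H →L[ℂ] H} (hA : 0 ≤ A) (x y : H) :
    ‖⟪A x, y⟫_ℂ‖ ^ 2 ≤ (⟪A x, x⟫_ℂ).re * (⟪A y, y⟫_ℂ).re := by
  have hS : ∀ u v : H, ⟪A u, v⟫_ℂ = ⟪CFC.sqrt A u, CFC.sqrt A v⟫_ℂ := fun u v => by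
    rw [← inner_apply_comm_of_nonneg (CFC.sqrt_nonneg A), ← mul_apply_eq_comp,
      CFC.sqrt_mul_sqrt_self A hA]
  have hn : ∀ u : H, (⟪A u, u⟫_ℂ).re = ‖CFC.sqrt A u‖ ^ 2 := fun u => by
    rw [hS]; exact inner_self_eq_norm_sq (𝕜 := ℂ) _
  rw [hn, hn, hS, ← mul_pow]
  exact pow_le_pow_left₀ (norm_nonneg _) (norm_inner_le_norm _ _) 2

theorem norm_inner_apply_apply_sq_le (T : H →L[ℂ] H) (x z : H) :
    ‖⟪T x, T z⟫_ℂ‖ ^ 2 ≤ (⟪opAbs T x, x⟫_ℂ).re * (⟪opAbs (star T) (T z), T z⟫_ℂ).re := by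
  have hA := opAbs_nonneg T
  have hT : ∀ u v : H, ⟪T u, T v⟫_ℂ = ⟪opAbs T u, opAbs T v⟫_ℂ := fun u v => by
    rw [← inner_apply_comm_of_nonneg hA, ← mul_apply_eq_comp, opAbs_mul_self,
      mul_apply_eq_comp, ContinuousLinearMap.star_eq_adjoint,
      ContinuousLinearMap.adjoint_inner_left]
  have hB : opAbs (star T) (T z) = T (opAbs T z) :=
    (DFunLike.congr_fun (mul_opAbs T) z).symm
  rw [hB, hT, hT]
  exact norm_inner_apply_sq_le_of_nonneg hA x (opAbs T z)

/-- The mixed Schwarz inequality `|⟨Tx, y⟩|² ≤ ⟨|T|x, x⟩ ⟨|T*|y, y⟩`. -/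
theorem norm_inner_apply_sq_le (T : H →L[ℂ] H) (x y : H) :
    ‖⟪T x, y⟫_ℂ‖ ^ 2 ≤ (⟪opAbs T x, x⟫_ℂ).re * (⟪opAbs (star T) y, y⟫_ℂ).re := by
  have hB := opAbs_nonneg (star T)
  set K := T.range.topologicalClosure with hK
  have hclosure : ∀ u ∈ K, ‖⟪T x, u⟫_ℂ‖ ^ 2 ≤
      (⟪opAbs T x, x⟫_ℂ).re * (⟪opAbs (star T) u, u⟫_ℂ).re := by
    intro u hu
    have hclosed : IsClosed {u : H | ‖⟪T x, u⟫_ℂ‖ ^ 2 ≤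
        (⟪opAbs T x, x⟫_ℂ).re * (⟪opAbs (star T) u, u⟫_ℂ).re} :=
      isClosed_le (by fun_prop) (by fun_prop)
    refine closure_minimal ?_ hclosed hu
    rintro _ ⟨z, rfl⟩
    exact norm_inner_apply_apply_sq_le T x z
  obtain ⟨u, hu, v, hv, rfl⟩ := K.exists_add_mem_mem_orthogonal y
  have hTv : ⟪T x, v⟫_ℂ = 0 :=
    Submodule.inner_right_of_mem_orthogonal
      (Submodule.le_topologicalClosure _ (LinearMap.mem_range_self _ x)) hv
  have hker : star T v = 0 := by
    rw [hK, Submodule.orthogonal_closure, ContinuousLinearMap.orthogonal_range] at hv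
    exact hv
  have hBv : opAbs (star T) v = 0 := by
    have h := congrArg (fun S : H →L[ℂ] H => S v) (opAbs_mul_self (star T))
    simp only [mul_apply_eq_comp, hker, map_zero] at h
    rw [← inner_self_eq_zero (𝕜 := ℂ), ← inner_apply_comm_of_nonneg hB, h, inner_zero_left]
  have hBu : ⟪opAbs (star T) (u + v), u + v⟫_ℂ = ⟪opAbs (star T) u, u⟫_ℂ := by
    rw [map_add, hBv, add_zero, inner_add_right, inner_apply_comm_of_nonneg hB u v, hBv,
      inner_zero_right, add_zero]
  rw [hBu, inner_add_right, hTv, add_zero]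
  exact hclosure u hu

theorem stmt3 [Nontrivial H] (T : H →L[ℂ] H) :
    numRadius T ^ 2 ≤
      (1 / 4 : ℝ) * ‖opAbs T + opAbs (star T)‖ ^ 2 -
        (1 / 4 : ℝ) *
          ⨅ x : {x : H // ‖x‖ = 1},
            ((⟪(opAbs T) x.1, x.1⟫_ℂ).re - (⟪(opAbs (star T)) x.1, x.1⟫_ℂ).re) ^ 2 := by
  set A := opAbs T
  set B := opAbs (star T)
  set m := ⨅ x : {x : H // ‖x‖ = 1}, ((⟪A x.1, x.1⟫_ℂ).re - (⟪B x.1, x.1⟫_ℂ).re) ^ 2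
  have hpoint (x : {x : H // ‖x‖ = 1}) :
      ‖⟪T x.1, x.1⟫_ℂ‖ ^ 2 ≤ (1 / 4 : ℝ) * ‖A + B‖ ^ 2 - (1 / 4 : ℝ) * m := by
    have hm : m ≤ ((⟪A x.1, x.1⟫_ℂ).re - (⟪B x.1, x.1⟫_ℂ).re) ^ 2 :=
      ciInf_le ⟨0, by rintro _ ⟨y, rfl⟩; positivity⟩ x
    have hsum : (⟪A x.1, x.1⟫_ℂ).re + (⟪B x.1, x.1⟫_ℂ).re ≤ ‖A + B‖ := by
      rw [← Complex.add_re, ← inner_add_left, ← add_apply]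
      refine (Complex.re_le_norm _).trans ((norm_inner_le_norm _ _).trans ?_)
      simpa [x.2] using (A + B).le_opNorm x.1
    have hsq := pow_le_pow_left₀ (add_nonneg (re_inner_apply_self_nonneg (opAbs_nonneg T) x.1)
      (re_inner_apply_self_nonneg (opAbs_nonneg (star T)) x.1)) hsum 2
    have hschwarz := norm_inner_apply_sq_le T x.1 x.1
    linarith
  obtain ⟨x₀, hx₀⟩ := exists_norm_eq H zero_le_one
  have : Nonempty {x : H // ‖x‖ = 1} := ⟨⟨x₀, hx₀⟩⟩
  have hnonneg := (sq_nonneg _).trans (hpoint ⟨x₀, hx₀⟩)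
  have hle : numRadius T ≤ √((1 / 4 : ℝ) * ‖A + B‖ ^ 2 - (1 / 4 : ℝ) * m) :=
    ciSup_le fun x => Real.le_sqrt_of_sq_le (hpoint x)
  exact (Real.le_sqrt (Real.iSup_nonneg fun _ => norm_nonneg _) hnonneg).mp hle
end

section
/- Let T be a bounded linear operator on a nontrivial complex Hilbert space H. Then w²(T|T|) ≤ (1/4) ‖ |T|² + |T*|² ‖² − (1/4) · inf_{‖x‖=1} ( ⟨|T|²x, x⟩ − ⟨|T*|²x, x⟩ ), equivalently w²(T|T|) ≤ (1/4) ‖ T*T + TT* ‖² − (1/4) · inf_{‖x‖=1} ( ⟨|T|²x, x⟩ − ⟨|T*|²x, x⟩ ). -/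
open scoped InnerProductSpace NNReal

variable {H : Type*} [NormedAddCommGroup H] [InnerProductSpace ℂ H] [CompleteSpace H]

theorem opAbs_sq (T : H →L[ℂ] H) : opAbs T ^ 2 = star T * T :=
  CFC.sq_sqrt _ (star_mul_self_nonneg T)

theorem isSelfAdjoint_opAbs (T : H →L[ℂ] H) : IsSelfAdjoint (opAbs T) :=
  IsSelfAdjoint.of_nonneg (CFC.sqrt_nonneg _)

theorem inner_star_mul_self (S : H →L[ℂ] H) (x : H) :
    ⟪(star S * S) x, x⟫_ℂ = ((‖S x‖ ^ 2 : ℝ) : ℂ) := by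
  rw [mul_apply_eq_comp, ContinuousLinearMap.star_eq_adjoint,
    ContinuousLinearMap.adjoint_inner_left, inner_self_eq_norm_sq_to_K]
  norm_cast

theorem re_inner_star_mul_self (S : H →L[ℂ] H) (x : H) :
    (⟪(star S * S) x, x⟫_ℂ).re = ‖S x‖ ^ 2 := by
  rw [inner_star_mul_self, Complex.ofReal_re]

theorem re_inner_mul_star_self (S : H →L[ℂ] H) (x : H) :
    (⟪(S * star S) x, x⟫_ℂ).re = ‖(star S) x‖ ^ 2 := by
  simpa using re_inner_star_mul_self (star S) x

theorem norm_opAbs_apply (T : H →L[ℂ] H) (x : H) : ‖opAbs T x‖ = ‖T x‖ := by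
  have h : ‖opAbs T x‖ ^ 2 = ‖T x‖ ^ 2 := by
    rw [← re_inner_star_mul_self, ← re_inner_star_mul_self, (isSelfAdjoint_opAbs T).star_eq,
      ← sq, opAbs_sq]
  exact (sq_eq_sq₀ (norm_nonneg _) (norm_nonneg _)).1 h

/-- The numerical radius of `T|T|` is at most half the norm of `T*T + TT*`. -/
theorem numRadius_mul_opAbs_le (T : H →L[ℂ] H) :
    numRadius (T * opAbs T) ≤ (1 / 2 : ℝ) * ‖star T * T + T * star T‖ := by
  refine Real.iSup_le (fun ⟨x, hx⟩ => ?_) (by positivity)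
  have h1 : ‖⟪(T * opAbs T) x, x⟫_ℂ‖ ≤ ‖T x‖ * ‖(star T) x‖ := by
    rw [mul_apply_eq_comp, ← ContinuousLinearMap.adjoint_inner_right,
      ← norm_opAbs_apply T x]
    exact norm_inner_le_norm _ _
  have h2 : ‖T x‖ ^ 2 + ‖(star T) x‖ ^ 2 ≤ ‖star T * T + T * star T‖ := by
    rw [← re_inner_star_mul_self, ← re_inner_mul_star_self, ← Complex.add_re, ← inner_add_left,
      ← add_apply]
    refine (Complex.re_le_norm _).trans ((norm_inner_le_norm _ _).trans ?_)
    simpa [hx] using (star T * T + T * star T).le_opNorm x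
  change ‖⟪(T * opAbs T) x, x⟫_ℂ‖ ≤ _
  nlinarith [sq_nonneg (‖T x‖ - ‖(star T) x‖)]

/-- The resolvents of an element of a complex Banach algebra are not uniformly bounded: they blow
up near the boundary of the spectrum. -/
theorem exists_resolvent_norm_gt {A : Type*} [NormedRing A] [NormedAlgebra ℂ A] [CompleteSpace A]
    [Nontrivial A] (a : A) (C : ℝ) :
    ∃ (z : ℂ) (u : Aˣ), (u : A) = algebraMap ℂ A z - a ∧ C < ‖(↑u⁻¹ : A)‖ := by
  by_contra! h
  have hne : spectrum ℂ a ≠ Set.univ := fun he =>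
    NormedSpace.unbounded_univ ℂ ℂ (he ▸ spectrum.isBounded a)
  obtain ⟨z, hz⟩ := nonempty_frontier_iff.2 ⟨spectrum.nonempty a, hne⟩
  rw [frontier_eq_closure_inter_closure, (spectrum.isClosed a).closure_eq] at hz
  obtain ⟨hz, hzc⟩ := hz
  obtain ⟨y, hy, hyz⟩ := Metric.mem_closure_iff.1 hzc (‖(1 : A)‖ * (|C| + 1))⁻¹
    (by have := norm_pos_iff.2 (one_ne_zero (α := A)); positivity)
  obtain ⟨u, hu⟩ := spectrum.notMem_iff.1 hy
  have hu1 : ‖(↑u⁻¹ : A)‖ < |C| + 1 := by linarith [h y u hu, le_abs_self C]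
  have hone := norm_pos_iff.2 (one_ne_zero (α := A))
  have hlt : ‖algebraMap ℂ A (z - y)‖ < ‖(↑u⁻¹ : A)‖⁻¹ := by
    rw [norm_algebraMap, ← dist_eq_norm]
    calc dist z y * ‖(1 : A)‖ < (‖(1 : A)‖ * (|C| + 1))⁻¹ * ‖(1 : A)‖ := by gcongr
      _ = (|C| + 1)⁻¹ := by field_simp
      _ ≤ ‖(↑u⁻¹ : A)‖⁻¹ := inv_anti₀ (norm_pos_iff.2 u⁻¹.ne_zero) hu1.le
  refine hz ⟨u.add _ hlt, ?_⟩
  rw [Units.val_add, hu, map_sub]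
  abel

theorem star_mul_self_sub_mul_star_self_algebraMap_sub (T : H →L[ℂ] H) (z : ℂ) :
    star (algebraMap ℂ (H →L[ℂ] H) z - T) * (algebraMap ℂ (H →L[ℂ] H) z - T) -
      (algebraMap ℂ (H →L[ℂ] H) z - T) * star (algebraMap ℂ (H →L[ℂ] H) z - T) =
    star T * T - T * star T := by
  simp only [Algebra.algebraMap_eq_smul_one, star_sub, star_smul, star_one, sub_mul, mul_sub,
    smul_mul_assoc, mul_smul_comm, one_mul, mul_one, smul_sub, smul_comm z (star z)]
  abel

/-- The self-commutator of a bounded operator is never bounded below by a positive scalar. -/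
theorem iInf_norm_sq_sub_norm_star_sq_nonpos [Nontrivial H] (T : H →L[ℂ] H) :
    ⨅ x : {x : H // ‖x‖ = 1}, (‖T x.1‖ ^ 2 - ‖(star T) x.1‖ ^ 2) ≤ 0 := by
  by_contra! hc
  set c := ⨅ x : {x : H // ‖x‖ = 1}, (‖T x.1‖ ^ 2 - ‖(star T) x.1‖ ^ 2)
  have hbdd : BddBelow (Set.range fun x : {x : H // ‖x‖ = 1} =>
      ‖T x.1‖ ^ 2 - ‖(star T) x.1‖ ^ 2) := by
    by_contra hb
    exact hc.ne' (Real.iInf_of_not_bddBelow hb)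
  have hunit (z : ℂ) (x : H) (hx : ‖x‖ = 1) :
      √c ≤ ‖(algebraMap ℂ (H →L[ℂ] H) z - T) x‖ := by
    set S := algebraMap ℂ (H →L[ℂ] H) z - T with hS
    have h1 : c ≤ ‖T x‖ ^ 2 - ‖(star T) x‖ ^ 2 := ciInf_le hbdd ⟨x, hx⟩
    have h2 : ‖S x‖ ^ 2 - ‖(star S) x‖ ^ 2 = ‖T x‖ ^ 2 - ‖(star T) x‖ ^ 2 := by
      simp only [← re_inner_star_mul_self, star_star, ← Complex.sub_re,
        ← inner_sub_left, ← sub_apply]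
      rw [hS, star_mul_self_sub_mul_star_self_algebraMap_sub]
    exact Real.sqrt_le_iff.2 ⟨norm_nonneg _, by nlinarith [sq_nonneg ‖(star S) x‖]⟩
  have hlow (z : ℂ) (x : H) : √c * ‖x‖ ≤ ‖(algebraMap ℂ (H →L[ℂ] H) z - T) x‖ := by
    rcases eq_or_ne x 0 with rfl | hx
    · simp
    · have h := hunit z ((‖x‖⁻¹ : ℂ) • x) (norm_smul_inv_norm hx)
      rw [map_smul, norm_smul, norm_inv, Complex.norm_real, norm_norm] at h
      rwa [← le_div_iff₀ (norm_pos_iff.2 hx), div_eq_inv_mul]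
  obtain ⟨z, u, hu, hgt⟩ := exists_resolvent_norm_gt T (√c)⁻¹
  refine hgt.not_ge (ContinuousLinearMap.opNorm_le_bound _ (by positivity) fun x => ?_)
  have h := hlow z ((↑u⁻¹ : H →L[ℂ] H) x)
  rw [← hu, ← mul_apply_eq_comp, Units.mul_inv, one_apply_eq_self] at h
  rwa [inv_mul_eq_div, le_div_iff₀' (Real.sqrt_pos.2 hc)]

theorem stmt8 [Nontrivial H] (T : H →L[ℂ] H) :
    numRadius (T * opAbs T) ^ 2 ≤
      (1 / 4 : ℝ) * ‖opAbs T ^ 2 + opAbs (star T) ^ 2‖ ^ 2 -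
        (1 / 4 : ℝ) *
          ⨅ x : {x : H // ‖x‖ = 1},
            ((⟪(opAbs T ^ 2) x.1, x.1⟫_ℂ).re - (⟪(opAbs (star T) ^ 2) x.1, x.1⟫_ℂ).re) ∧
    numRadius (T * opAbs T) ^ 2 ≤
      (1 / 4 : ℝ) * ‖star T * T + T * star T‖ ^ 2 -
        (1 / 4 : ℝ) *
          ⨅ x : {x : H // ‖x‖ = 1},
            ((⟪(opAbs T ^ 2) x.1, x.1⟫_ℂ).re - (⟪(opAbs (star T) ^ 2) x.1, x.1⟫_ℂ).re) := by
  have hw : numRadius (T * opAbs T) ^ 2 ≤ (1 / 4 : ℝ) * ‖star T * T + T * star T‖ ^ 2 := by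
    have h0 : 0 ≤ numRadius (T * opAbs T) := Real.iSup_nonneg fun _ => norm_nonneg _
    nlinarith [pow_le_pow_left₀ h0 (numRadius_mul_opAbs_le T) 2]
  have hinf := iInf_norm_sq_sub_norm_star_sq_nonpos T
  simp only [opAbs_sq, star_star, re_inner_star_mul_self, re_inner_mul_star_self]
  constructor <;> linarith
end
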